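/- arXiv:2003.01411 — 2 statements merged into one kernel-verified Lean document; each statement's English description precedes it below -/
import Mathlib

section
/- Let f : (0,∞) → ℝ be convex. Then the perspective function g(p, q) = q · f(p/q) is jointly convex on the open positive quadrant {(p, q) ∈ ℝ² : p > 0, q > 0}; consequently, for vectors p, q with positive entries, the Csiszár divergence C_f(p‖q) = Σᵢ qᵢ f(pᵢ/qᵢ) is jointly convex in (p, q). -/
lemma comb_pos {a b x y : ℝ} (ha : 0 ≤ a) (hb : 0 ≤ b) (hab : a + b = 1)
    (hx : 0 < x) (hy : 0 < y) : 0 < a * x + b * y := by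
  have h := (convex_Ioi (0 : ℝ)) (Set.mem_Ioi.2 hx) (Set.mem_Ioi.2 hy) ha hb hab
  simpa using h

lemma persp_ineq (f : ℝ → ℝ) (hconv : ConvexOn ℝ (Set.Ioi 0) f) {a b p q r s : ℝ}
    (ha : 0 ≤ a) (hb : 0 ≤ b) (hab : a + b = 1)
    (hp : 0 < p) (hq : 0 < q) (hr : 0 < r) (hs : 0 < s) :
    (a * q + b * s) * f ((a * p + b * r) / (a * q + b * s)) ≤
      a * (q * f (p / q)) + b * (s * f (r / s)) := by
  have hD := comb_pos ha hb hab hq hs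
  set D := a * q + b * s with hDdef
  have h := hconv.2 (Set.mem_Ioi.2 (div_pos hp hq)) (Set.mem_Ioi.2 (div_pos hr hs))
    (show 0 ≤ a * q / D by positivity) (show 0 ≤ b * s / D by positivity)
    (by rw [← add_div, ← hDdef, div_self hD.ne'])
  simp only [smul_eq_mul] at h
  have e : a * q / D * (p / q) + b * s / D * (r / s) = (a * p + b * r) / D := by
    field_simp
  rw [e] at h
  have h2 := mul_le_mul_of_nonneg_left h hD.le
  have e2 : D * (a * q / D * f (p / q) + b * s / D * f (r / s)) =
      a * (q * f (p / q)) + b * (s * f (r / s)) := by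
    have h3 : D ≠ 0 := hD.ne'
    clear_value D
    generalize f (p / q) = u
    generalize f (r / s) = v
    field_simp
  rwa [e2] at h2


/-- The perspective `(p, q) ↦ q * f (p/q)` of a convex `f` on `(0,∞)`
is jointly convex on the open positive quadrant; consequently the Csiszár divergence
is jointly convex on pairs of positive vectors. -/
theorem statement3 {n : ℕ} (f : ℝ → ℝ) (hconv : ConvexOn ℝ (Set.Ioi 0) f) :
    ConvexOn ℝ {x : ℝ × ℝ | 0 < x.1 ∧ 0 < x.2} (fun x => x.2 * f (x.1 / x.2)) ∧
    ConvexOn ℝ {x : (Fin n → ℝ) × (Fin n → ℝ) | (∀ i, 0 < x.1 i) ∧ (∀ i, 0 < x.2 i)}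
      (fun x => ∑ i, x.2 i * f (x.1 i / x.2 i)) := by

  refine ⟨⟨?_, ?_⟩, ⟨?_, ?_⟩⟩
  · rintro ⟨p, q⟩ ⟨hp, hq⟩ ⟨r, s⟩ ⟨hr, hs⟩ a b ha hb hab
    exact ⟨comb_pos ha hb hab hp hr, comb_pos ha hb hab hq hs⟩
  · rintro ⟨p, q⟩ ⟨hp, hq⟩ ⟨r, s⟩ ⟨hr, hs⟩ a b ha hb hab
    exact persp_ineq f hconv ha hb hab hp hq hr hs
  · rintro ⟨p, q⟩ ⟨hp, hq⟩ ⟨r, s⟩ ⟨hr, hs⟩ a b ha hb hab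
    exact ⟨fun i => comb_pos ha hb hab (hp i) (hr i), fun i => comb_pos ha hb hab (hq i) (hs i)⟩
  · rintro ⟨p, q⟩ ⟨hp, hq⟩ ⟨r, s⟩ ⟨hr, hs⟩ a b ha hb hab
    simp only [smul_eq_mul, Finset.mul_sum, ← Finset.sum_add_distrib]
    exact Finset.sum_le_sum fun i _ =>
      persp_ineq f hconv ha hb hab (hp i) (hq i) (hr i) (hs i)
end

section
/- Let f : ℝ → ℝ be twice continuously differentiable and convex, and let 0 < α < 1. Then for all p, q ∈ ℝ, the Bregman divergence is the sum of the convergent series b_f(p, q) = Σ_{n=1}^{∞} α^{−n} · j_f^α( α^{n−1}·p + (1 − α^{n−1})·q , q ), where b_f(a, b) = f(a) − f(b) − (a − b)·f'(b) and j_f^α(a, b) = α f(a) + (1−α) f(b) − f(αa + (1−α)b). -/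
/-- For `f` twice continuously differentiable and convex, and `0 < α < 1`,
the Bregman divergence is the sum of the convergent series
`b_f(p,q) = ∑_{n=1}^∞ α^{-n} j_f^α(α^{n-1} p + (1 - α^{n-1}) q, q)`
(indexed below by `m = n - 1`). -/
theorem statement8 (f : ℝ → ℝ) (hf : ContDiff ℝ 2 f) (hconv : ConvexOn ℝ Set.univ f)
    (α : ℝ) (hα0 : 0 < α) (hα1 : α < 1) (p q : ℝ) :
    HasSum
      (fun m : ℕ =>
        (α ^ (m + 1))⁻¹ *
          (α * f (α ^ m * p + (1 - α ^ m) * q) + (1 - α) * f q -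
            f (α * (α ^ m * p + (1 - α ^ m) * q) + (1 - α) * q)))
      (f p - f q - (p - q) * deriv f q) := by
  have hpos : ∀ n : ℕ, 0 < α ^ n := fun n => pow_pos hα0 n
  rw [hasSum_iff_tendsto_nat_of_nonneg]
  · have hsum : ∀ N : ℕ, ∑ m ∈ Finset.range N, (α ^ (m + 1))⁻¹ *
          (α * f (α ^ m * p + (1 - α ^ m) * q) + (1 - α) * f q -
            f (α * (α ^ m * p + (1 - α ^ m) * q) + (1 - α) * q))
        = f p - f q - (α ^ N)⁻¹ * (f (q + (0 + α ^ N) * (p - q)) - f q) := by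
      intro N
      induction N with
      | zero => simp
      | succ k ih =>
        rw [Finset.sum_range_succ, ih]
        have e1 : α ^ k * p + (1 - α ^ k) * q = q + (0 + α ^ k) * (p - q) := by ring
        have e2 : α * (q + (0 + α ^ k) * (p - q)) + (1 - α) * q
            = q + (0 + α ^ (k + 1)) * (p - q) := by ring
        rw [e1, e2]
        have h1 := (hpos k).ne'
        have h2 := hα0.ne'
        generalize f (q + (0 + α ^ (k + 1)) * (p - q)) = A
        generalize f (q + (0 + α ^ k) * (p - q)) = B
        rw [pow_succ]
        field_simp
        ring
    simp_rw [hsum]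
    refine Filter.Tendsto.const_sub _ ?_
    have hd : HasDerivAt (fun t : ℝ => f (q + t * (p - q))) ((p - q) * deriv f q) 0 := by
      have hfd : HasDerivAt f (deriv f q) (q + 0 * (p - q)) := by
        have h := ((hf.differentiable (by norm_num)) q).hasDerivAt
        simpa using h
      have hl : HasDerivAt (fun t : ℝ => q + t * (p - q)) (p - q) 0 := by
        simpa using ((hasDerivAt_id (0 : ℝ)).mul_const (p - q)).const_add q
      have := hfd.comp (0 : ℝ) hl
      rw [mul_comm] at this
      exact this
    have ht : Filter.Tendsto (fun n : ℕ => α ^ n) Filter.atTop (nhdsWithin 0 {0}ᶜ) := by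
      rw [tendsto_nhdsWithin_iff]
      exact ⟨tendsto_pow_atTop_nhds_zero_of_lt_one hα0.le hα1,
        Filter.Eventually.of_forall fun n => (hpos n).ne'⟩
    have := hd.tendsto_slope_zero.comp ht
    simpa [Function.comp_def] using this
  · intro m
    refine mul_nonneg (inv_nonneg.mpr (hpos _).le) ?_
    have := hconv.2 (Set.mem_univ (α ^ m * p + (1 - α ^ m) * q)) (Set.mem_univ q) hα0.le
      (sub_nonneg.mpr hα1.le) (by ring)
    simp only [smul_eq_mul] at this
    linarith
end
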